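/- arXiv:1902.09231 — 3 statements merged into one kernel-verified Lean document; each statement's English description precedes it below -/
import Mathlib

section
/- For every integer n ≥ 396, one has log n + log log n − 1 + (log log n − 2.1454)/log n ≥ (1 − 1/log n + (log log n)/(4·log² n)) · (log n + log log n + (log log n − 0.8 + 0.018)/log n). -/
open Real

lemma log_ge_log_add_one_sub_div {a x : ℝ} (ha : 0 < a) (hx : 0 < x) :
    Real.log a + (1 - a / x) ≤ Real.log x := by
  have h := Real.one_sub_inv_le_log_of_pos (div_pos hx ha)
  rw [Real.log_div hx.ne' ha.ne', inv_div] at h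
  linarith

lemma log_396_lower_bound : (5.9814 : ℝ) ≤ Real.log 396 := by
  rw [Real.le_log_iff_exp_le (by norm_num)]
  have hsplit : Real.exp 5.9814 * Real.exp 0.0186 = Real.exp 1 ^ 6 := by
    rw [← Real.exp_add, ← Real.exp_nat_mul]; norm_num
  have he : Real.exp 1 ^ 6 ≤ 2.7182818286 ^ 6 :=
    pow_le_pow_left₀ (Real.exp_pos _).le Real.exp_one_lt_d9.le 6
  have hq := Real.sum_le_exp_of_nonneg (x := 0.0186) (by norm_num) 4
  norm_num [Finset.sum_range_succ, Nat.factorial] at hq hsplit he ⊢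
  nlinarith [Real.exp_pos (29907 / 5000)]

lemma log_5_9814_lower_bound : (1.7886 : ℝ) ≤ Real.log 5.9814 := by
  rw [Real.le_log_iff_exp_le (by norm_num)]
  have hsplit : Real.exp 1.7886 * Real.exp 0.2114 = Real.exp 1 ^ 2 := by
    rw [← Real.exp_add, ← Real.exp_nat_mul]; norm_num
  have he : Real.exp 1 ^ 2 ≤ 2.7182818286 ^ 2 :=
    pow_le_pow_left₀ (Real.exp_pos _).le Real.exp_one_lt_d9.le 2
  have hq := Real.sum_le_exp_of_nonneg (x := 0.2114) (by norm_num) 6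
  norm_num [Finset.sum_range_succ, Nat.factorial] at hq hsplit he ⊢
  nlinarith [Real.exp_pos (8943 / 5000)]

/-- The difference of the two sides, multiplied by `4 * L ^ 3`, is nonnegative for `l = log L`. -/
lemma numerator_nonneg {L l : ℝ} (hL : 5.9814 ≤ L) (hlL : l ≤ L)
    (hl : 1.7886 + (1 - 5.9814 / L) ≤ l) :
    0 ≤ 4 * L ^ 2 * (0.75 * l - 1.3634) + L * (4 * l - 3.128 - l ^ 2) - l * (l - 0.782) := by
  have hL0 : 0 < L := by linarith
  obtain ⟨m, hm⟩ : ∃ m : ℝ, m = 1.7886 + (1 - 5.9814 / L) := ⟨_, rfl⟩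
  rw [← hm] at hl
  have hmL : L * m = 2.7886 * L - 5.9814 := by
    rw [hm]; field_simp; ring
  have hm2 : m ≤ 2.7886 := by
    rw [hm]; have : 0 < 5.9814 / L := by positivity
    linarith
  have hbase : 0 ≤ 4 * L ^ 2 * (0.75 * m - 1.3634) + L * (4 * m - 3.128 - m ^ 2)
      - m * (m - 0.782) := by
    have hpoly : 0 ≤ 4 * L ^ 4 * 0.75 * 2.7886 - 4 * L ^ 3 * 0.75 * 5.9814 - 4 * L ^ 4 * 1.3634
        + L ^ 2 * (4 * (2.7886 * L - 5.9814)) - 3.128 * L ^ 3 - L * (2.7886 * L - 5.9814) ^ 2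
        - (2.7886 * L - 5.9814) * (2.7886 * L - 5.9814 - 0.782 * L) := by
      obtain ⟨s, rfl⟩ : ∃ s, L = 5.9814 + s := ⟨L - 5.9814, by ring⟩
      have hs : 0 ≤ s := by linarith
      ring_nf
      positivity
    refine nonneg_of_mul_nonneg_right ?_ (pow_pos hL0 2)
    rw [← hmL] at hpoly
    linear_combination hpoly + (3 * L ^ 3) * hmL.symm
  have hmono : 0 ≤ (l - m) * (3 * L ^ 2 + 4 * L - L * (l + m) - (l + m) + 0.782) := by
    apply mul_nonneg (by linarith)
    nlinarith
  linear_combination hbase + hmono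

theorem G_ge_F_mul_U (n : ℕ) (hn : 396 ≤ n) :
    Real.log n + Real.log (Real.log n) - 1 +
        (Real.log (Real.log n) - 2.1454) / Real.log n ≥
      (1 - 1 / Real.log n + Real.log (Real.log n) / (4 * (Real.log n) ^ 2)) *
        (Real.log n + Real.log (Real.log n) +
          (Real.log (Real.log n) - 0.8 + 0.018) / Real.log n) := by
  have hL : (5.9814 : ℝ) ≤ Real.log n :=
    log_396_lower_bound.trans (Real.log_le_log (by norm_num) (by exact_mod_cast hn))
  generalize Real.log n = L at hL ⊢
  have hL0 : 0 < L := by linarith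
  have hl := log_ge_log_add_one_sub_div (a := 5.9814) (by norm_num) hL0
  have hnum := numerator_nonneg (l := Real.log L) hL (Real.log_le_self hL0.le)
    (by linarith [log_5_9814_lower_bound])
  generalize Real.log L = l at hnum ⊢
  rw [ge_iff_le, ← sub_nonneg]
  have hdiff : L + l - 1 + (l - 2.1454) / L -
      (1 - 1 / L + l / (4 * L ^ 2)) * (L + l + (l - 0.8 + 0.018) / L) =
      (4 * L ^ 2 * (0.75 * l - 1.3634) + L * (4 * l - 3.128 - l ^ 2) - l * (l - 0.782)) /
        (4 * L ^ 3) := by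
    field_simp
    ring
  rw [hdiff]
  positivity
end

section
/- For every integer n ≥ 2, one has log n + log log n − 1 + (log log n − 2)/log n ≤ (1 − 1/log n + (log log n)/(log² n)) · (log n + log log n + (log log n − 1)/(log n + 0.5·(log log n − 1))). -/
open Real

/-- Clearing denominators reduces the inequality to the sign of a cubic polynomial. -/
lemma G_le_F_mul_V_of_cubic_nonneg {x y : ℝ} (hx : 0 < x) (hD : 0 < x + 0.5 * (y - 1))
    (h : 0 ≤ x ^ 2 + x * (y * (y + 1)) / 2 + y * (y - 1) * (y + 2) / 2) :
    x + y - 1 + (y - 2) / x ≤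
      (1 - 1 / x + y / x ^ 2) * (x + y + (y - 1) / (x + 0.5 * (y - 1))) := by
  rw [← sub_nonneg]
  have key : (1 - 1 / x + y / x ^ 2) * (x + y + (y - 1) / (x + 0.5 * (y - 1))) -
      (x + y - 1 + (y - 2) / x) =
      (x ^ 2 + x * (y * (y + 1)) / 2 + y * (y - 1) * (y + 2) / 2) /
        (x ^ 2 * (x + 0.5 * (y - 1))) := by
    generalize hd : x + 0.5 * (y - 1) = D at hD
    have hxD : x = D - (y - 1) / 2 := by linarith
    have hx0 := hx.ne'
    have hD0 := hD.ne'
    field_simp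
    rw [hxD]
    ring
  rw [key]
  positivity

lemma one_sub_two_mul_log_two_lt_log_log_two : 1 - 2 * log 2 < log (log 2) := by
  have h4 : (4 : ℝ) = 2 ^ 2 := by norm_num
  have h : log (exp 1 / 4) < log (log 2) :=
    log_lt_log (by positivity) (by linarith [exp_one_lt_d9, log_two_gt_d9])
  rw [log_div (exp_pos 1).ne' (by norm_num), log_exp, h4, log_pow] at h
  exact_mod_cast h

theorem G_le_F_mul_V (n : ℕ) (hn : 2 ≤ n) :
    Real.log n + Real.log (Real.log n) - 1 +
        (Real.log (Real.log n) - 2) / Real.log n ≤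
      (1 - 1 / Real.log n + Real.log (Real.log n) / (Real.log n) ^ 2) *
        (Real.log n + Real.log (Real.log n) +
          (Real.log (Real.log n) - 1) /
            (Real.log n + 0.5 * (Real.log (Real.log n) - 1))) := by
  obtain rfl | hn3 := hn.eq_or_lt
  · have hx := log_two_gt_d9
    have hx' := log_two_lt_d9
    have hy := one_sub_two_mul_log_two_lt_log_log_two
    have hy' : log (log 2) < 0 := log_neg (by linarith) (by linarith)
    push_cast
    refine G_le_F_mul_V_of_cubic_nonneg (by linarith) (by linarith) ?_
    generalize log (log 2) = y at *
    generalize log 2 = x at *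
    have h1 : 0 ≤ y * (y - 1) * (y + 2) :=
      mul_nonneg (mul_nonneg_of_nonpos_of_nonpos hy'.le (by linarith)) (by linarith)
    have h2 : 0 ≤ x * (x + y * (y + 1) / 2) :=
      mul_nonneg (by linarith) (by nlinarith [sq_nonneg (y + 1 / 2)])
    linarith
  · have hx : 1 < log n := by
      rw [lt_log_iff_exp_lt (by positivity)]
      have : (3 : ℝ) ≤ n := by exact_mod_cast hn3
      linarith [exp_one_lt_d9]
    have hy : 0 < log (log n) := log_pos hx
    refine G_le_F_mul_V_of_cubic_nonneg (by linarith) (by linarith) ?_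
    generalize log (log n) = y at *
    generalize log (n : ℝ) = x at *
    have h1 : 0 ≤ (x - 1) * (y * (y + 1)) := mul_nonneg (by linarith) (by positivity)
    have h2 : 0 ≤ y ^ 3 := by positivity
    nlinarith [sq_nonneg (y - 1 / 4)]
end

section
/- For every ε with 0 < ε < 1, there exists a natural number m_ε such that for every integer n ≥ m_ε one has log n + log log n − 1 + (log log n − 2.1454)/log n ≥ (1 − 1/log n + (1−ε)·(log log n)/(log² n)) · (log n + log log n + (log log n − 0.8 + 0.018)/log n). -/
open Real

theorem G_ge_F_mul_U_of_large {ε x y : ℝ} (hε0 : 0 < ε) (hε1 : ε < 1) (hy : 1 ≤ y)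
    (hεy : 4 ≤ ε * y) (hx : 1 ≤ x) (hxy : 2 * y ^ 2 ≤ x) :
    x + y - 1 + (y - 2.1454) / x ≥
      (1 - 1 / x + (1 - ε) * y / x ^ 2) * (x + y + (y - 0.8 + 0.018) / x) := by
  have hx0 : 0 < x := by linarith
  have key : 0 ≤ x ^ 2 * (ε * y - 1.3634) + x * (y - 0.782 - (1 - ε) * y ^ 2)
      - (1 - ε) * (y * (y - 0.782)) := by
    have h1 : x ^ 2 ≤ x ^ 2 * (ε * y - 1.3634) :=
      le_mul_of_one_le_right (by positivity) (by linarith)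
    have h2 : x * (-y ^ 2) ≤ x * (y - 0.782 - (1 - ε) * y ^ 2) :=
      mul_le_mul_of_nonneg_left (by nlinarith [mul_nonneg hε0.le (sq_nonneg y)]) hx0.le
    have h3 : (1 - ε) * (y * (y - 0.782)) ≤ y ^ 2 := by
      have h : 0 ≤ y * (y - 0.782) := mul_nonneg (by linarith) (by linarith)
      nlinarith [mul_nonneg hε0.le h]
    have h4 : x * (2 * y ^ 2) ≤ x * x := mul_le_mul_of_nonneg_left hxy hx0.le
    have h5 : y ^ 2 ≤ x * y ^ 2 := le_mul_of_one_le_left (sq_nonneg y) hx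
    linarith
  have hdiff : x + y - 1 + (y - 2.1454) / x -
      (1 - 1 / x + (1 - ε) * y / x ^ 2) * (x + y + (y - 0.8 + 0.018) / x) =
      (x ^ 2 * (ε * y - 1.3634) + x * (y - 0.782 - (1 - ε) * y ^ 2)
        - (1 - ε) * (y * (y - 0.782))) / x ^ 3 := by
    field_simp
    ring
  exact sub_nonneg.mp (hdiff ▸ div_nonneg key (by positivity))

theorem G_ge_F_mul_U_eps (ε : ℝ) (hε0 : 0 < ε) (hε1 : ε < 1) :
    ∃ M : ℕ, ∀ n : ℕ, M ≤ n →
      Real.log n + Real.log (Real.log n) - 1 +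
          (Real.log (Real.log n) - 2.1454) / Real.log n ≥
        (1 - 1 / Real.log n + (1 - ε) * Real.log (Real.log n) / (Real.log n) ^ 2) *
          (Real.log n + Real.log (Real.log n) +
            (Real.log (Real.log n) - 0.8 + 0.018) / Real.log n) := by
  have hlog : Filter.Tendsto (fun n : ℕ => Real.log n) Filter.atTop Filter.atTop :=
    tendsto_log_atTop.comp tendsto_natCast_atTop_atTop
  have hsq : ∀ᶠ x : ℝ in Filter.atTop, 2 * Real.log x ^ 2 ≤ x := by
    filter_upwards [(isLittleO_pow_log_id_atTop (n := 2)).bound (c := 1 / 2) (by norm_num),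
      Filter.eventually_ge_atTop 0] with x hx hx0
    simp only [id, norm_pow, norm_eq_abs, sq_abs, abs_of_nonneg hx0] at hx
    linarith
  have hlarge : ∀ᶠ x : ℝ in Filter.atTop,
      2 * Real.log x ^ 2 ≤ x ∧ 1 ≤ x ∧ 1 ≤ Real.log x ∧ 4 / ε ≤ Real.log x := by
    filter_upwards [hsq, Filter.eventually_ge_atTop 1, tendsto_log_atTop.eventually_ge_atTop 1,
      tendsto_log_atTop.eventually_ge_atTop (4 / ε)] with x hxy hx hy hεy
    exact ⟨hxy, hx, hy, hεy⟩
  obtain ⟨M, hM⟩ := Filter.eventually_atTop.mp (hlog.eventually hlarge)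
  refine ⟨M, fun n hn => ?_⟩
  obtain ⟨hxy, hx, hy, hεy⟩ := hM n hn
  exact G_ge_F_mul_U_of_large hε0 hε1 hy ((div_le_iff₀' hε0).mp hεy) hx hxy
end
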